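/- In the net tower setup, for every k ∈ ℤ and y ∈ N_k, the set closure(D_k(y)), equipped with the restriction of the metric d, is K_D²-doubling and K_P′-uniformly perfect, where K_P′ := 2·a·K_P·(1−a^{-1})^{-1}·(2^{-1} − (a−1)^{-1})^{-1}. -/

import Mathlib

open Metric Set Filter Topology
open scoped ENNReal

noncomputable section

/-- A metric space `(X,d)` is `K`-doubling: every ball of radius `r` can be covered by at most
`K` balls of radius `r/2`. -/
def IsDoublingWith (X : Type*) [PseudoMetricSpace X] (K : ℝ) : Prop :=
  ∀ (x : X) (r : ℝ), 0 < r → ∃ t : Finset X, (t.card : ℝ) ≤ K ∧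
    Metric.ball x r ⊆ ⋃ y ∈ t, Metric.ball y (r / 2)

/-- A metric space `(X,d)` is `K`-uniformly perfect. -/
def IsUniformlyPerfectWith (X : Type*) [PseudoMetricSpace X] (K : ℝ) : Prop :=
  ∀ (x : X) (r : ℝ), 0 < r → ((Metric.ball x r)ᶜ).Nonempty →
    (Metric.ball x r \ Metric.ball x (r / K)).Nonempty

/-- `N` is an `ε`-net in the subspace `Y` of `X`: `N ⊆ Y`, `N` is `ε`-separated, and `N` is
maximal among `ε`-separated subsets of `Y`. -/
def IsNetIn (X : Type*) [PseudoMetricSpace X] (ε : ℝ) (N Y : Set X) : Prop :=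
  N ⊆ Y ∧ (∀ x ∈ N, ∀ y ∈ N, x ≠ y → ε ≤ dist x y) ∧
    ∀ M : Set X, N ⊆ M → M ⊆ Y →
      (∀ x ∈ M, ∀ y ∈ M, x ≠ y → ε ≤ dist x y) → M = N

/-- A net tower on `(X,d)` with parameter `a`: a base point `x₀`, an `a⁻ᵏ`-net `N k` in `X` for
every integer `k ≥ 0` (nested, with `x₀ ∈ N 0`), an `a⁻ᵏ`-net `N k` in the subspace `N (k+1)`
(containing `x₀`) for `k < 0`, and a choice `P k x ∈ N (k-1)` of a nearest point of `N (k-1)`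
to each `x ∈ N k` (a predecessor). -/
structure NetTower (X : Type*) [MetricSpace X] (a : ℝ) where
  x₀ : X
  N : ℤ → Set X
  isNet_nonneg : ∀ k : ℤ, 0 ≤ k → IsNetIn X (a ^ (-k)) (N k) Set.univ
  nested : ∀ k : ℤ, 0 ≤ k → N k ⊆ N (k + 1)
  x₀_mem : ∀ k : ℤ, k ≤ 0 → x₀ ∈ N k
  isNet_neg : ∀ k : ℤ, k < 0 → IsNetIn X (a ^ (-k)) (N k) (N (k + 1))
  P : ℤ → X → X
  P_mem : ∀ k : ℤ, ∀ x ∈ N k, P k x ∈ N (k - 1)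
  P_nearest : ∀ k : ℤ, ∀ x ∈ N k, ∀ z ∈ N (k - 1), dist x (P k x) ≤ dist x z

namespace NetTower

variable {X : Type*} [MetricSpace X] {a : ℝ}

/-- `iterP T j l z`: the `j`-fold iterated predecessor `P^j(z)` of `z ∈ N l`
(which lies in `N (l - j)`). -/
def iterP (T : NetTower X a) : ℕ → ℤ → X → X
  | 0, _, z => z
  | j + 1, l, z => iterP T j (l - 1) (T.P l z)

/-- The descendants `D_k(y) = {y} ∪ {z ∈ N_l : l > k, P^{l-k}(z) = y}` of `y ∈ N k`. -/
def D (T : NetTower X a) (k : ℤ) (y : X) : Set X :=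
  {y} ∪ {z : X | ∃ l : ℤ, k < l ∧ z ∈ T.N l ∧ T.iterP (l - k).toNat l z = y}

end NetTower

/-- The subset `Y` of `X`, with the restricted metric, is `K`-doubling: every ball of `Y` of
radius `r` can be covered by at most `K` balls of `Y` of radius `r/2` with centers in `Y`. -/
def DoublingOn {X : Type*} [PseudoMetricSpace X] (Y : Set X) (K : ℝ) : Prop :=
  ∀ x ∈ Y, ∀ r : ℝ, 0 < r → ∃ t : Finset X, ↑t ⊆ Y ∧ (t.card : ℝ) ≤ K ∧
    Y ∩ Metric.ball x r ⊆ ⋃ y ∈ t, Metric.ball y (r / 2)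

/-- The subset `Y` of `X`, with the restricted metric, is `K`-uniformly perfect. -/
def UniformlyPerfectOn {X : Type*} [PseudoMetricSpace X] (Y : Set X) (K : ℝ) : Prop :=
  ∀ x ∈ Y, ∀ r : ℝ, 0 < r → (Y \ Metric.ball x r).Nonempty →
    ((Y ∩ Metric.ball x r) \ Metric.ball x (r / K)).Nonempty

lemma net_cover {X : Type*} [MetricSpace X] {ε : ℝ} {N Y : Set X}
    (h : IsNetIn X ε N Y) (hε : 0 < ε) {z : X} (hz : z ∈ Y) : ∃ w ∈ N, dist z w < ε := by
  by_contra hcon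
  push Not at hcon
  obtain ⟨h1, h2, h3⟩ := h
  have := h3 (insert z N) (Set.subset_insert _ _) (Set.insert_subset hz h1) (by
    rintro x (rfl | hx) w (rfl | hw) hxw
    · exact absurd rfl hxw
    · exact hcon w hw
    · rw [dist_comm]; exact hcon x hx
    · exact h2 x hx w hw hxw)
  have hzN : z ∈ N := by rw [← this]; exact Set.mem_insert _ _
  have := hcon z hzN
  simp at this
  linarith

namespace NetTower

section aux
variable {X : Type*} [MetricSpace X] {a : ℝ}

lemma step (T : NetTower X a) (k : ℤ) : T.N k ⊆ T.N (k + 1) := by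
  rcases lt_or_ge k 0 with h | h
  · exact (T.isNet_neg k h).1
  · exact T.nested k h

lemma mono_add (T : NetTower X a) (k : ℤ) (j : ℕ) : T.N k ⊆ T.N (k + j) := by
  induction j with
  | zero => simp
  | succ j ih =>
    intro x hx
    have := T.step _ (ih hx)
    rw [add_assoc] at this
    exact_mod_cast this

lemma sep (T : NetTower X a) (k : ℤ) {x y : X} (hx : x ∈ T.N k) (hy : y ∈ T.N k)
    (hne : x ≠ y) : a ^ (-k) ≤ dist x y := by
  rcases lt_or_ge k 0 with h | h
  · exact (T.isNet_neg k h).2.1 x hx y hy hne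
  · exact (T.isNet_nonneg k h).2.1 x hx y hy hne

lemma P_dist (T : NetTower X a) (ha : 8 < a) (l : ℤ) {z : X} (hz : z ∈ T.N l) :
    dist z (T.P l z) < a ^ (-(l - 1)) := by
  have hpos : 0 < a ^ (-(l - 1)) := zpow_pos (by linarith) _
  have : ∃ w ∈ T.N (l - 1), dist z w < a ^ (-(l - 1)) := by
    rcases lt_or_ge (l - 1) 0 with h | h
    · exact net_cover (T.isNet_neg (l - 1) h) hpos (by simpa using hz)
    · exact net_cover (T.isNet_nonneg (l - 1) h) hpos (Set.mem_univ _)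
  obtain ⟨w, hw, hd⟩ := this
  exact (T.P_nearest l z hz w hw).trans_lt hd

lemma P_self (T : NetTower X a) (l : ℤ) {z : X} (hz : z ∈ T.N l) : T.P (l + 1) z = z := by
  have := T.P_nearest (l + 1) z (T.step l hz) z (by simpa using hz)
  rw [dist_self] at this
  exact (dist_le_zero.1 this).symm

lemma iterP_mem (T : NetTower X a) (j : ℕ) : ∀ (l m : ℤ) (z : X), z ∈ T.N l → l = m + j →
    T.iterP j l z ∈ T.N m := by
  induction j with
  | zero => intro l m z hz h; simp at h; subst h; exact hz
  | succ j ih =>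
    intro l m z hz h
    exact ih (l - 1) m _ (T.P_mem l z hz) (by push_cast at h; linarith)

lemma iterP_dist (T : NetTower X a) (ha : 8 < a) (j : ℕ) : ∀ (l m : ℤ) (z : X), z ∈ T.N l →
    l = m + j → dist z (T.iterP j l z) ≤ (1 - a⁻¹)⁻¹ * (a ^ (-m) - a ^ (-l)) := by
  induction j with
  | zero => intro l m z hz h; simp at h; subst h; simp [iterP]
  | succ j ih =>
    intro l m z hz h
    have h1 := ih (l - 1) m _ (T.P_mem l z hz) (by push_cast at h; linarith)
    have h2 := (T.P_dist ha l hz).le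
    have h3 := dist_triangle z (T.P l z) (T.iterP j (l - 1) (T.P l z))
    have h4 : a ^ (-(l - 1)) = (1 - a⁻¹)⁻¹ * (a ^ (-(l - 1)) - a ^ (-l)) := by
      have ha0 : a ≠ 0 := by linarith
      have hb : a - 1 ≠ 0 := by linarith
      have : a ^ (-(l - 1)) = a ^ (-l) * a := by
        rw [← zpow_add_one₀ ha0]; congr 1; ring
      rw [this]
      field_simp
    show dist z (T.iterP j (l - 1) (T.P l z)) ≤ _
    nlinarith

lemma iterP_add (T : NetTower X a) (i j : ℕ) : ∀ (l m : ℤ) (z : X), l = m + i →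
    T.iterP (i + j) l z = T.iterP j m (T.iterP i l z) := by
  induction i with
  | zero => intro l m z h; simp at h; subst h; simp [iterP]
  | succ i ih =>
    intro l m z h
    rw [show i + 1 + j = (i + j) + 1 by ring]
    exact ih (l - 1) m _ (by push_cast at h; linarith)

/-- Auxiliary form of the descendants. -/
def D' (T : NetTower X a) (k : ℤ) (y : X) : Set X :=
  {z : X | ∃ j : ℕ, z ∈ T.N (k + j) ∧ T.iterP j (k + j) z = y}

lemma D_eq (T : NetTower X a) (k : ℤ) (y : X) (hy : y ∈ T.N k) : T.D k y = T.D' k y := by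
  ext z
  constructor
  · rintro (h | ⟨l, hl, hz, h⟩)
    · rw [Set.mem_singleton_iff] at h
      subst h
      exact ⟨0, by simpa using hy, rfl⟩
    · have e : k + ((l - k).toNat : ℤ) = l := by omega
      exact ⟨(l - k).toNat, by rw [e]; exact hz, by rw [e]; exact h⟩
  · rintro ⟨j, hz, h⟩
    rcases Nat.eq_zero_or_pos j with rfl | hj
    · left; exact h
    · right
      refine ⟨k + j, by omega, hz, ?_⟩
      have e : (k + (j : ℤ) - k).toNat = j := by omega
      rw [e]; exact h

lemma iterP_extend (T : NetTower X a) (k : ℤ) (j i : ℕ) {z y : X} (hz : z ∈ T.N (k + j))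
    (h : T.iterP j (k + j) z = y) :
    z ∈ T.N (k + (j + i : ℕ)) ∧ T.iterP (j + i) (k + (j + i : ℕ)) z = y := by
  induction i with
  | zero => exact ⟨hz, h⟩
  | succ i ih =>
    obtain ⟨h1, h2⟩ := ih
    have e : k + ((j + (i + 1) : ℕ) : ℤ) = k + ((j + i : ℕ) : ℤ) + 1 := by push_cast; ring
    rw [e]
    refine ⟨T.step _ h1, ?_⟩
    show T.iterP (j + i) (k + ((j + i : ℕ) : ℤ) + 1 - 1) (T.P (k + ((j + i : ℕ) : ℤ) + 1) z) = y
    rw [T.P_self _ h1, add_sub_cancel_right, h2]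

lemma near_iterP (T : NetTower X a) (ha : 8 < a) (m : ℤ) (j : ℕ) {p q : X} (hp : p ∈ T.N m)
    (hq : q ∈ T.N (m + (j + 1 : ℕ)))
    (hd : dist q p < (2⁻¹ - (a - 1)⁻¹) * a ^ (-m)) :
    T.iterP (j + 1) (m + (j + 1 : ℕ)) q = p := by
  rw [T.iterP_add j 1 _ (m + 1) q (by push_cast; ring)]
  have hw := T.iterP_mem j _ (m + 1) q hq (by push_cast; ring)
  have hwd := T.iterP_dist ha j _ (m + 1) q hq (by push_cast; ring)
  set w := T.iterP j (m + (j + 1 : ℕ)) q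
  show T.P (m + 1) w = p
  have h1 := T.P_nearest (m + 1) w hw p (by simpa using hp)
  have h2 := T.P_mem (m + 1) w hw
  rw [add_sub_cancel_right] at h2
  have hpos : 0 < a ^ (-(m + ((j + 1 : ℕ) : ℤ))) := zpow_pos (by linarith) _
  have ha0 : a ≠ 0 := by linarith
  have hb : a - 1 ≠ 0 := by linarith
  have hbpos : 0 < (1 - a⁻¹)⁻¹ := by
    have : a⁻¹ < 1 := inv_lt_one_of_one_lt₀ (by linarith)
    exact inv_pos.2 (by linarith)
  have h4 : (1 - a⁻¹)⁻¹ * a ^ (-(m + 1)) = (a - 1)⁻¹ * a ^ (-m) := by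
    have : a ^ (-m) = a ^ (-(m + 1)) * a := by
      rw [← zpow_add_one₀ ha0]; congr 1; ring
    rw [this]
    field_simp
  have h5 : dist q w ≤ (a - 1)⁻¹ * a ^ (-m) := by
    rw [← h4]; nlinarith
  by_contra hne
  have h6 := T.sep m h2 hp hne
  have h7 := dist_triangle (T.P (m + 1) w) w p
  have h8 := dist_triangle w q p
  rw [dist_comm (T.P (m + 1) w) w] at h7
  rw [dist_comm w q] at h8
  nlinarith

lemma dense (T : NetTower X a) (ha : 8 < a) (m : ℤ) (z : X) {ε : ℝ} (hε : 0 < ε) :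
    ∃ j : ℕ, ∃ w ∈ T.N (m + (j + 1 : ℕ)), dist z w < ε := by
  obtain ⟨n, hn⟩ := exists_pow_lt_of_lt_one hε
    (inv_lt_one_of_one_lt₀ (show (1 : ℝ) < a by linarith))
  have h0 : (0 : ℤ) ≤ n := by positivity
  obtain ⟨w, hw, hd⟩ := net_cover (T.isNet_nonneg n h0) (zpow_pos (by linarith) _)
    (Set.mem_univ z)
  have e : a ^ (-(n : ℤ)) = a⁻¹ ^ n := by simp
  rw [e] at hd
  refine ⟨((n : ℤ) - m).toNat, w, ?_, hd.trans hn⟩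
  have := T.mono_add n (m + ((((n : ℤ) - m).toNat + 1 : ℕ) : ℤ) - n).toNat hw
  convert this using 2
  push_cast
  omega

lemma ball_subset (T : NetTower X a) (ha : 8 < a) (m : ℤ) {p : X} (hp : p ∈ T.N m) :
    ball p ((2⁻¹ - (a - 1)⁻¹) * a ^ (-m)) ⊆ closure (T.D' m p) := by
  intro z hz
  rw [Metric.mem_closure_iff]
  intro ε hε
  rw [mem_ball] at hz
  obtain ⟨j, w, hw, hd⟩ := T.dense ha m z (lt_min hε (sub_pos.2 hz))
  refine ⟨w, ⟨j + 1, hw, T.near_iterP ha m j hp hw ?_⟩, hd.trans_le (min_le_left _ _)⟩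
  have := hd.trans_le (min_le_right _ _)
  have h3 := dist_triangle w z p
  rw [dist_comm w z] at h3
  linarith

lemma D'_subset (T : NetTower X a) (k : ℤ) (i : ℕ) {p y : X}
    (h : T.iterP i (k + i) p = y) : T.D' (k + i) p ⊆ T.D' k y := by
  rintro q ⟨j, hq, hj⟩
  have e : k + (i : ℤ) + j = k + ((j + i : ℕ) : ℤ) := by push_cast; ring
  rw [e] at hq hj
  refine ⟨j + i, hq, ?_⟩
  rw [T.iterP_add j i _ (k + i) q (by push_cast; ring), hj, h]

lemma closure_dist (T : NetTower X a) (ha : 8 < a) (k : ℤ) {x y : X}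
    (hx : x ∈ closure (T.D' k y)) : dist x y ≤ (1 - a⁻¹)⁻¹ * a ^ (-k) := by
  have hbpos : 0 < (1 - a⁻¹)⁻¹ := by
    have : a⁻¹ < 1 := inv_lt_one_of_one_lt₀ (by linarith)
    exact inv_pos.2 (by linarith)
  have : closure (T.D' k y) ⊆ closedBall y ((1 - a⁻¹)⁻¹ * a ^ (-k)) := by
    refine closure_minimal ?_ isClosed_closedBall
    rintro q ⟨j, hq, hj⟩
    have := T.iterP_dist ha j _ k q hq rfl
    rw [hj] at this
    have hpos : 0 < a ^ (-(k + (j : ℤ))) := zpow_pos (by linarith) _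
    rw [mem_closedBall]
    nlinarith
  exact this hx

lemma exists_center (T : NetTower X a) (ha : 8 < a) (k : ℤ) (i : ℕ) {x y : X}
    (hx : x ∈ closure (T.D' k y)) {δ : ℝ} (hδ : 0 < δ) :
    ∃ p : X, ball p ((2⁻¹ - (a - 1)⁻¹) * a ^ (-(k + i))) ⊆ closure (T.D' k y) ∧
      dist x p < (1 - a⁻¹)⁻¹ * a ^ (-(k + i)) + δ := by
  have hbpos : 0 < (1 - a⁻¹)⁻¹ := by
    have : a⁻¹ < 1 := inv_lt_one_of_one_lt₀ (by linarith)
    exact inv_pos.2 (by linarith)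
  obtain ⟨q, ⟨j, hq, hj⟩, hd⟩ := Metric.mem_closure_iff.1 hx δ hδ
  obtain ⟨hq', hj'⟩ := T.iterP_extend k j i hq hj
  have e : k + ((j + i : ℕ) : ℤ) = (k + i) + j := by push_cast; ring
  rw [T.iterP_add j i _ (k + i) q e] at hj'
  have hp := T.iterP_mem j _ (k + i) q hq' e
  have hpd := T.iterP_dist ha j _ (k + i) q hq' e
  set p := T.iterP j (k + ((j + i : ℕ) : ℤ)) q
  refine ⟨p, (T.ball_subset ha _ hp).trans (closure_mono (T.D'_subset k i hj')), ?_⟩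
  have hpos : 0 < a ^ (-(k + ((j + i : ℕ) : ℤ))) := zpow_pos (by linarith) _
  have := dist_triangle x q p
  nlinarith

end aux

end NetTower

lemma doublingOn_of_isDoublingWith {X : Type*} [MetricSpace X] {K : ℝ} (hK : 1 ≤ K)
    (h : IsDoublingWith X K) (Y : Set X) : DoublingOn Y (K ^ 2) := by
  classical
  intro x hx r hr
  obtain ⟨t, htc, ht⟩ := h x r hr
  choose u huc hu using fun y : X => h y (r / 2) (by linarith)
  let v := (t.biUnion u).filter fun c => (Y ∩ ball c (r / 2 / 2)).Nonempty
  let f : X → X := fun c =>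
    if hc : (Y ∩ ball c (r / 2 / 2)).Nonempty then hc.choose else c
  have hf : ∀ c, (Y ∩ ball c (r / 2 / 2)).Nonempty → f c ∈ Y ∩ ball c (r / 2 / 2) := by
    intro c hc
    simp only [f, dif_pos hc]
    exact hc.choose_spec
  refine ⟨v.image f, ?_, ?_, ?_⟩
  · intro z hz
    simp only [Finset.coe_image, Set.mem_image, Finset.mem_coe, v, Finset.mem_filter] at hz
    obtain ⟨c, ⟨_, hc⟩, rfl⟩ := hz
    exact (hf c hc).1
  · have h1 : (v.image f).card ≤ (t.biUnion u).card :=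
      Finset.card_image_le.trans (Finset.card_filter_le _ _)
    have h2 : (t.biUnion u).card ≤ ∑ c ∈ t, (u c).card := Finset.card_biUnion_le
    calc ((v.image f).card : ℝ) ≤ ((∑ c ∈ t, (u c).card : ℕ) : ℝ) := by
          exact_mod_cast h1.trans h2
      _ = ∑ c ∈ t, ((u c).card : ℝ) := by push_cast; rfl
      _ ≤ ∑ c ∈ t, K := Finset.sum_le_sum fun c _ => huc c
      _ = t.card * K := by simp
      _ ≤ K ^ 2 := by nlinarith
  · rintro z ⟨hzY, hz⟩
    obtain ⟨c, hc, hzc⟩ := Set.mem_iUnion₂.1 (ht hz)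
    obtain ⟨e, he, hze⟩ := Set.mem_iUnion₂.1 (hu c hzc)
    have hne : (Y ∩ ball e (r / 2 / 2)).Nonempty := ⟨z, hzY, hze⟩
    refine Set.mem_iUnion₂.2 ⟨f e, Finset.mem_image_of_mem _
      (Finset.mem_filter.2 ⟨Finset.mem_biUnion.2 ⟨c, hc, he⟩, hne⟩), ?_⟩
    have h1 := (hf e hne).2
    rw [mem_ball] at *
    have := dist_triangle_right z (f e) e
    linarith

/-- Lemma 3.14(c), second part: for every `k ∈ ℤ` and `y ∈ N k`, the closure of the descendant
set `D_k(y)` with the restricted metric is `K_D²`-doubling and `K_P′`-uniformly perfect, where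
`K_P′ = 2aK_P(1−a⁻¹)⁻¹(2⁻¹−(a−1)⁻¹)⁻¹`. -/
theorem netTower_descendants_doubling_uniformlyPerfect
    (X : Type) [MetricSpace X] [CompleteSpace X]
    (KD KP a : ℝ) (hKD : 1 ≤ KD) (hKP : 1 < KP) (ha : 8 < a)
    (hdoub : IsDoublingWith X KD) (hperf : IsUniformlyPerfectWith X KP)
    (hdiam : EMetric.diam (Set.univ : Set X) = ENNReal.ofReal (1 / 2) ∨
      EMetric.diam (Set.univ : Set X) = ⊤)
    (T : NetTower X a)
    (k : ℤ) (y : X) (hy : y ∈ T.N k) :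
    DoublingOn (closure (T.D k y)) (KD ^ 2) ∧
      UniformlyPerfectOn (closure (T.D k y))
        (2 * a * KP * (1 - a⁻¹)⁻¹ * (2⁻¹ - (a - 1)⁻¹)⁻¹) := by
  
  refine ⟨doublingOn_of_isDoublingWith hKD hdoub _, ?_⟩
  rw [T.D_eq k y hy]
  intro x hx r hr ⟨w, hw, hwr⟩
  rw [mem_ball, not_lt] at hwr
  have hainv : a⁻¹ < 1 := inv_lt_one_of_one_lt₀ (by linarith)
  have hainv0 : 0 < a⁻¹ := inv_pos.2 (by linarith)
  have hb1 : 1 < (1 - a⁻¹)⁻¹ := (one_lt_inv₀ (by linarith)).2 (by linarith)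
  have hc0 : 0 < 2⁻¹ - (a - 1)⁻¹ := by
    have : (a - 1)⁻¹ < 2⁻¹ := by
      rw [inv_lt_inv₀ (by linarith) (by norm_num)]; linarith
    linarith
  have hc1 : 2⁻¹ - (a - 1)⁻¹ < 1 / 2 := by
    have : 0 < (a - 1)⁻¹ := inv_pos.2 (by linarith)
    norm_num; linarith
  have hcen := fun i : ℕ => fun δ : ℝ => T.exists_center ha k i (δ := δ) hx
  have hdx := T.closure_dist ha k hx
  have hdw := T.closure_dist ha k hw
  set b := (1 - a⁻¹)⁻¹
  set c := 2⁻¹ - (a - 1)⁻¹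
  set Y := closure (T.D' k y)
  have hr2 : r ≤ 2 * (b * a ^ (-k)) := by
    have := dist_triangle_right w x y
    linarith
  have hb0 : 0 < b := by linarith
  -- choose the scale
  obtain ⟨i, hi1, hi2⟩ : ∃ i : ℕ, b * a ^ (-(k + (i : ℤ))) < r ∧
      r ≤ a * (b * a ^ (-(k + (i : ℤ)))) := by
    rcases lt_or_ge (b * a ^ (-k)) r with h | h
    · refine ⟨0, by simpa using h, ?_⟩
      have : 0 < b * a ^ (-k) := mul_pos hb0 (zpow_pos (by linarith) _)
      simp only [Nat.cast_zero, add_zero]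
      nlinarith
    · obtain ⟨n, hn1, hn2⟩ := exists_mem_Ioc_zpow (div_pos hr hb0)
        (show (1 : ℝ) < a by linarith)
      have h3 : a ^ n < a ^ (-k) := hn1.trans_le (by rw [div_le_iff₀ hb0]; linarith)
      have h4 : n < -k := (zpow_lt_zpow_iff_right₀ (by linarith)).1 h3
      refine ⟨(-n - k).toNat, ?_⟩
      have e : -(k + ((-n - k).toNat : ℤ)) = n := by omega
      rw [e]
      rw [lt_div_iff₀ hb0] at hn1
      rw [div_le_iff₀ hb0, zpow_add_one₀ (by linarith)] at hn2
      constructor <;> linarith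
  obtain ⟨p, hpY, hpd⟩ := hcen i (r - b * a ^ (-(k + (i : ℤ)))) (by linarith)
  set s := a ^ (-(k + (i : ℤ)))
  have hs0 : 0 < s := zpow_pos (by linarith) _
  have hpr : dist x p < r := by linarith
  set K := 2 * a * KP * b * c⁻¹ with hK
  have hcinv : 2 < c⁻¹ := by
    rw [lt_inv_comm₀ (by norm_num) hc0]; linarith
  have hK8 : 2 < K := by
    have h1 : 1 < a * KP := by nlinarith
    have h2 : 1 < a * KP * b := by nlinarith
    have : K = 2 * (a * KP * b) * c⁻¹ := by rw [hK]; ring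
    rw [this]; nlinarith
  have hK0 : 0 < K := by linarith
  have hrK : r / K < r / 2 := div_lt_div_of_pos_left hr (by norm_num) hK8
  have hcs : c * s < r / 2 := by nlinarith
  have hpc : p ∈ Y := hpY (mem_ball_self (mul_pos hc0 hs0))
  by_cases hcase : r / K ≤ dist x p
  · refine ⟨p, ⟨hpc, ?_⟩, ?_⟩
    · rw [mem_ball, dist_comm]; exact hpr
    · rw [mem_ball, dist_comm, not_lt]; exact hcase
  · push Not at hcase
    obtain ⟨z, hz1, hz2⟩ := hperf p (c * s) (mul_pos hc0 hs0) ⟨w, by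
      rw [Set.mem_compl_iff, mem_ball, not_lt]
      have := dist_triangle w p x
      rw [dist_comm p x] at this
      linarith⟩
    have hzY := hpY hz1
    rw [mem_ball] at hz1 hz2
    rw [not_lt] at hz2
    have hkey : 2 * (r / K) ≤ c * s / KP := by
      have hKP0 : 0 < KP := by linarith
      have ha0 : 0 < a := by linarith
      have : 2 * (r / K) = c * r / (a * b) / KP := by
        rw [hK]; field_simp
      rw [this]
      gcongr
      rw [div_le_iff₀ (by positivity)]
      nlinarith
    refine ⟨z, ⟨hzY, ?_⟩, ?_⟩
    · rw [mem_ball]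
      have := dist_triangle z p x
      rw [dist_comm p x] at this
      linarith
    · rw [mem_ball, not_lt]
      have := dist_triangle z x p
      linarith
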